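/- There exists a normalized block basis (u_i) of the unit vector basis (e_i) of the Schlumprecht space S, with each u_i a normalized multiple of a sum of consecutive basis vectors (constant coefficients), such that the closed linear span of (u_i) is isomorphic to S, and for no permutation π of ℕ is the sequence (u_{π(i)}) equivalent to (e_i). In particular, S does not have a unique unconditional basis. -/

import Mathlib

open Filter Topology

noncomputable section

/-- `f(t) = log₂(t+1)`. -/
def schF (t : ℝ) : ℝ := Real.logb 2 (t + 1)

/-- For a finitely supported scalar sequence `a`, the vector `Σᵢ aᵢ eᵢ`. -/
def embed {S : Type*} [NormedAddCommGroup S] [NormedSpace ℝ S] (e : ℕ → S) (a : ℕ →₀ ℝ) : S :=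
  a.sum fun i c => c • e i

/-- The restriction `Ex` of `x = Σ aᵢ eᵢ` to the coordinates in the finite set `E`. -/
def restr (a : ℕ →₀ ℝ) (E : Finset ℕ) : ℕ →₀ ℝ := a.filter (· ∈ E)

/-- `E₁ < E₂ < ⋯ < E_r` : a successive family of finite subsets of ℕ. -/
def Succ {r : ℕ} (E : Fin r → Finset ℕ) : Prop :=
  ∀ i j : Fin r, i < j → ∀ m ∈ E i, ∀ n ∈ E j, m < n

/-- `S` is (a realization of) the Schlumprecht space with unit vector basis `e`:
a Banach space in which the span of `e` is dense and whose norm satisfies, on the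
finitely supported vectors `Σ aᵢ eᵢ`, the implicit Schlumprecht equation. -/
structure IsSchlumprecht (S : Type*) [NormedAddCommGroup S] [NormedSpace ℝ S] (e : ℕ → S) :
    Prop where
  dense_span : Dense (Submodule.span ℝ (Set.range e) : Set S)
  norm_eq : ∀ a : ℕ →₀ ℝ,
    ‖embed e a‖ = max (⨆ i, |a i|)
      (sSup {c : ℝ | ∃ r : ℕ, 2 ≤ r ∧ ∃ E : Fin r → Finset ℕ, Succ E ∧
        c = (schF r)⁻¹ * ∑ i, ‖embed e (restr a (E i))‖})

/-- `b` is a normalized block basis of the unit vector basis `e`. -/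
def IsNormalizedBlockBasis {S : Type*} [NormedAddCommGroup S] [NormedSpace ℝ S] (e : ℕ → S)
    (b : ℕ → ℕ →₀ ℝ) : Prop :=
  (∀ k, b k ≠ 0) ∧ (∀ k, ∀ m ∈ (b k).support, ∀ n ∈ (b (k + 1)).support, m < n) ∧
  (∀ k, ‖embed e (b k)‖ = 1)

/-- The series `Σ g k` converges to `s` (convergence of partial sums). -/
def SeriesSum {S : Type*} [AddCommMonoid S] [TopologicalSpace S] (g : ℕ → S) (s : S) : Prop :=
  Tendsto (fun m => ∑ k ∈ Finset.range m, g k) atTop (𝓝 s)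

/-- `V` is isomorphic (linearly homeomorphic) to the S-sum `(Σₖ ⊕ X k)_S`,
where the S-sum consists of all `y : Π k, X k` such that `Σₖ ‖y k‖ e k` converges in `S`,
normed by `‖Σₖ ‖y k‖ e k‖`. -/
def IsoToSSum {S : Type*} [NormedAddCommGroup S] [NormedSpace ℝ S] (e : ℕ → S)
    (V : Type*) [NormedAddCommGroup V] [Module ℝ V]
    (X : ℕ → Type*) [∀ k, NormedAddCommGroup (X k)] [∀ k, Module ℝ (X k)] : Prop :=
  ∃ (T : V →ₗ[ℝ] Π k, X k) (A B : ℝ), 0 < A ∧ 0 < B ∧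
    (Set.range T = {y | ∃ s : S, SeriesSum (fun k => ‖y k‖ • e k) s}) ∧
    ∀ v : V, ∃ s : S, SeriesSum (fun k => ‖T v k‖ • e k) s ∧
      A * ‖v‖ ≤ ‖s‖ ∧ ‖s‖ ≤ B * ‖v‖

/-- Two sequences `(u k)`, `(v k)` (in possibly different normed spaces) are equivalent:
there are constants `A, B > 0` with `(1/A)‖Σ aₖ uₖ‖ ≤ ‖Σ aₖ vₖ‖ ≤ B‖Σ aₖ uₖ‖`
for all finitely supported scalars. -/
def SeqEquivalent {U V : Type*} [NormedAddCommGroup U] [Module ℝ U]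
    [NormedAddCommGroup V] [Module ℝ V] (u : ℕ → U) (v : ℕ → V) : Prop :=
  ∃ A B : ℝ, 0 < A ∧ 0 < B ∧ ∀ a : ℕ →₀ ℝ,
    A⁻¹ * ‖a.sum fun i c => c • u i‖ ≤ ‖a.sum fun i c => c • v i‖ ∧
    ‖a.sum fun i c => c • v i‖ ≤ B * ‖a.sum fun i c => c • u i‖

section Basics

variable {S : Type*} [NormedAddCommGroup S] [NormedSpace ℝ S] {e : ℕ → S}

lemma embed_eq_linearCombination (a : ℕ →₀ ℝ) : embed e a = Finsupp.linearCombination ℝ e a := rfl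

lemma embed_add (a b : ℕ →₀ ℝ) : embed e (a + b) = embed e a + embed e b := by
  simp [embed_eq_linearCombination]

lemma embed_sub (a b : ℕ →₀ ℝ) : embed e (a - b) = embed e a - embed e b := by
  simp [embed_eq_linearCombination]

lemma embed_smul (c : ℝ) (a : ℕ →₀ ℝ) : embed e (c • a) = c • embed e a := by
  simp [embed_eq_linearCombination]

lemma embed_zero : embed e 0 = 0 := by
  simp [embed_eq_linearCombination]

lemma restr_apply (a : ℕ →₀ ℝ) (E : Finset ℕ) (i : ℕ) :
    restr a E i = if i ∈ E then a i else 0 := by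
  simp [restr, Finsupp.filter_apply]

lemma support_restr (a : ℕ →₀ ℝ) (E : Finset ℕ) : (restr a E).support ⊆ a.support :=
  Finset.filter_subset _ _

lemma Succ.disjoint {r : ℕ} {E : Fin r → Finset ℕ} (hE : Succ E) {i j : Fin r} (hij : i ≠ j)
    {m : ℕ} (hi : m ∈ E i) : m ∉ E j := by
  intro hj
  rcases lt_or_gt_of_ne hij with h | h
  · exact lt_irrefl _ (hE i j h m hi m hj)
  · exact lt_irrefl _ (hE j i h m hj m hi)

/-- Summing over the members of a successive family counts each point at most once. -/
lemma Succ.sum_sum_le {r : ℕ} {E : Fin r → Finset ℕ} (hE : Succ E) (F : Finset ℕ) {w : ℕ → ℝ}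
    (hw : ∀ i, 0 ≤ w i) : ∑ i, ∑ m ∈ F with m ∈ E i, w m ≤ ∑ m ∈ F, w m := by
  rw [← Finset.sum_biUnion]
  · refine Finset.sum_le_sum_of_subset_of_nonneg ?_ fun m _ _ => hw m
    intro m hm
    simp only [Finset.mem_biUnion, Finset.mem_filter] at hm
    exact hm.choose_spec.2.1
  · intro i _ j _ hij
    refine Finset.disjoint_left.2 fun m hm hm' => ?_
    exact hE.disjoint hij (Finset.mem_filter.1 hm).2 (Finset.mem_filter.1 hm').2

lemma schF_mono {s t : ℝ} (hs : 0 ≤ s) (h : s ≤ t) : schF s ≤ schF t :=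
  Real.logb_le_logb_of_le (by norm_num) (by linarith) (by linarith)

lemma one_lt_schF {t : ℝ} (ht : 2 ≤ t) : 1 < schF t := by
  rw [schF, Real.lt_logb_iff_rpow_lt (by norm_num) (by linarith)]
  norm_num
  linarith

lemma one_lt_schF_nat {r : ℕ} (hr : 2 ≤ r) : 1 < schF r := one_lt_schF (by exact_mod_cast hr)

lemma bddAbove_schlumprecht_sums (e : ℕ → S) (a : ℕ →₀ ℝ) :
    BddAbove {c : ℝ | ∃ r : ℕ, 2 ≤ r ∧ ∃ E : Fin r → Finset ℕ, Succ E ∧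
    c = (schF r)⁻¹ * ∑ i, ‖embed e (restr a (E i))‖} := by
  refine ⟨∑ m ∈ a.support, ‖a m • e m‖, ?_⟩
  rintro _ ⟨r, hr, E, hE, rfl⟩
  have h1 : (schF r)⁻¹ ≤ 1 := inv_le_one_of_one_le₀ (one_lt_schF_nat hr).le
  have h2 : ∑ i, ‖embed e (restr a (E i))‖ ≤ ∑ m ∈ a.support, ‖a m • e m‖ := by
    refine le_trans (Finset.sum_le_sum fun i _ => ?_)
      (hE.sum_sum_le a.support (w := fun m => ‖a m • e m‖) fun _ => norm_nonneg _)
    have : embed e (restr a (E i)) = ∑ m ∈ a.support with m ∈ E i, a m • e m := by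
      rw [embed, Finsupp.sum, restr, Finsupp.support_filter]
      refine Finset.sum_congr rfl fun m hm => ?_
      rw [Finsupp.filter_apply_pos _ _ (Finset.mem_filter.1 hm).2]
    rw [this]
    exact norm_sum_le _ _
  calc _ ≤ 1 * ∑ i, ‖embed e (restr a (E i))‖ := by gcongr
    _ ≤ _ := by rwa [one_mul]

namespace IsSchlumprecht

variable (hS : IsSchlumprecht S e)
include hS

lemma abs_le_norm (a : ℕ →₀ ℝ) (i : ℕ) : |a i| ≤ ‖embed e a‖ := by
  rw [hS.norm_eq]
  refine le_max_of_le_left (le_ciSup (f := fun i => |a i|) ?_ i)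
  have : (Set.range fun i => |a i|) = abs '' Set.range a := by
    rw [← Set.range_comp]; rfl
  rw [this]
  exact (a.finite_range.image _).bddAbove

lemma sum_restr_le (a : ℕ →₀ ℝ) {r : ℕ} (hr : 2 ≤ r) {E : Fin r → Finset ℕ} (hE : Succ E) :
    ∑ i, ‖embed e (restr a (E i))‖ ≤ schF r * ‖embed e a‖ := by
  have h0 : 0 < schF r := by linarith [one_lt_schF_nat hr]
  have : (schF r)⁻¹ * ∑ i, ‖embed e (restr a (E i))‖ ≤ ‖embed e a‖ := by
    rw [hS.norm_eq a]
    exact le_max_of_le_right (le_csSup (bddAbove_schlumprecht_sums e a) ⟨r, hr, E, hE, rfl⟩)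
  rwa [inv_mul_le_iff₀ h0] at this

/-- The Schlumprecht norm is dominated by every supersolution of the implicit equation. -/
theorem norm_le_of_supersolution {R : (ℕ →₀ ℝ) → ℝ → Prop}
    (h_sup : ∀ a m, R a m → ∀ i, |a i| ≤ m)
    (h_split : ∀ a m, R a m → ∀ r : ℕ, 2 ≤ r → ∀ E : Fin r → Finset ℕ, Succ E →
      ∃ m' : Fin r → ℝ, (∀ i, R (restr a (E i)) (m' i)) ∧ ∑ i, m' i ≤ schF r * m)
    (a : ℕ →₀ ℝ) (m : ℝ) (ha : R a m) : ‖embed e a‖ ≤ m := by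
  induction hn : a.support.card using Nat.strong_induction_on generalizing a m with
  | _ n ih =>
  subst hn
  have hm : 0 ≤ m := (abs_nonneg _).trans (h_sup a m ha 0)
  have h2 : 1 < schF 2 := one_lt_schF le_rfl
  have key : ‖embed e a‖ ≤ max m (‖embed e a‖ / schF 2) := by
    conv_lhs => rw [hS.norm_eq a]
    refine max_le (le_max_of_le_left (Real.iSup_le (h_sup a m ha) hm)) (csSup_le ?_ ?_)
    · exact ⟨_, 2, le_rfl, fun _ => ∅, by simp [Succ], rfl⟩
    · rintro _ ⟨r, hr, E, hE, rfl⟩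
      have hr1 := one_lt_schF_nat hr
      rw [inv_mul_le_iff₀ (by linarith)]
      by_cases hsm : ∀ i, (restr a (E i)).support.card < a.support.card
      · obtain ⟨m', hm', hsum⟩ := h_split a m ha r hr E hE
        calc ∑ i, ‖embed e (restr a (E i))‖ ≤ ∑ i, m' i :=
              Finset.sum_le_sum fun i _ => ih _ (hsm i) _ _ (hm' i) rfl
          _ ≤ schF r * m := hsum
          _ ≤ _ := by gcongr; exact le_max_left _ _
      · push Not at hsm
        obtain ⟨i₀, hi₀⟩ := hsm
        have hsupp := Finset.eq_of_subset_of_card_le (support_restr a (E i₀)) hi₀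
        have hmem : ∀ m, a m ≠ 0 → m ∈ E i₀ := by
          intro m hm
          have : m ∈ (restr a (E i₀)).support := by rw [hsupp]; simpa using hm
          by_contra hc
          simp [restr_apply, hc] at this
        have h_eq : restr a (E i₀) = a := by
          ext m
          rw [restr_apply]
          split_ifs with h
          · rfl
          · by_contra hc
            exact h (hmem m (Ne.symm hc))
        have h_ne : ∀ i, i ≠ i₀ → restr a (E i) = 0 := by
          intro i hi
          ext m
          rw [restr_apply]
          split_ifs with h
          · by_contra hc
            exact hE.disjoint hi h (hmem m hc)
          · rfl
        rw [Finset.sum_eq_single i₀ (fun i _ hi => by rw [h_ne i hi, embed_zero, norm_zero])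
          (by simp), h_eq]
        have h2r : schF 2 ≤ schF r := schF_mono (by norm_num) (by exact_mod_cast hr)
        calc ‖embed e a‖ = schF 2 * (‖embed e a‖ / schF 2) := by field_simp
          _ ≤ schF r * (‖embed e a‖ / schF 2) := by gcongr
          _ ≤ _ := by gcongr; exact le_max_right _ _
  rcases le_max_iff.1 key with h | h
  · exact h
  · rw [le_div_iff₀ (by linarith)] at h
    nlinarith [norm_nonneg (embed e a)]

/-- The Schlumprecht norm is `1`-unconditional and `1`-spreading. -/
theorem norm_le_of_strictMonoOn {a b : ℕ →₀ ℝ} {φ : ℕ → ℕ} (hφ : StrictMonoOn φ a.support)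
    (hab : ∀ i ∈ a.support, |a i| ≤ |b (φ i)|) : ‖embed e a‖ ≤ ‖embed e b‖ := by
  refine hS.norm_le_of_supersolution
    (R := fun a m => ∃ b : ℕ →₀ ℝ, ∃ φ : ℕ → ℕ, StrictMonoOn φ a.support ∧
      (∀ i ∈ a.support, |a i| ≤ |b (φ i)|) ∧ m = ‖embed e b‖) ?_ ?_ a _ ⟨b, φ, hφ, hab, rfl⟩
  · rintro a _ ⟨b, φ, -, hab, rfl⟩ i
    by_cases hi : i ∈ a.support
    · exact (hab i hi).trans (hS.abs_le_norm b _)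
    · rw [Finsupp.notMem_support_iff.1 hi, abs_zero]
      exact norm_nonneg _
  · rintro a _ ⟨b, φ, hφ, hab, rfl⟩ r hr E hE
    refine ⟨fun i => ‖embed e (restr b ((a.support.filter (· ∈ E i)).image φ))‖, fun i => ?_,
      hS.sum_restr_le b hr ?_⟩
    · refine ⟨_, φ, hφ.mono (support_restr a (E i)), fun k hk => ?_, rfl⟩
      have hka := support_restr a (E i) hk
      have hkE : k ∈ E i := by
        by_contra hc
        simp [restr_apply, hc] at hk
      rw [restr_apply, restr_apply, if_pos hkE, if_pos]
      · exact hab k hka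
      · exact Finset.mem_image_of_mem _ (Finset.mem_filter.2 ⟨hka, hkE⟩)
    · intro i j hij m hm n hn
      simp only [Finset.mem_image, Finset.mem_filter] at hm hn
      obtain ⟨m, ⟨hm, hmE⟩, rfl⟩ := hm
      obtain ⟨n, ⟨hn, hnE⟩, rfl⟩ := hn
      exact hφ hm hn (hE i j hij m hmE n hnE)

/-- Lower estimate by the functional that splits a set into singletons. -/
lemma sum_le_schF_mul_norm (a : ℕ →₀ ℝ) {r : ℕ} (hr : 2 ≤ r) :
    ∑ i ∈ Finset.range r, |a i| ≤ schF r * ‖embed e a‖ := by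
  refine le_trans ?_ (hS.sum_restr_le a hr (E := fun i => {(i : ℕ)}) ?_)
  · rw [Finset.sum_range]
    refine Finset.sum_le_sum fun i _ => ?_
    simpa [restr_apply] using hS.abs_le_norm (restr a {(i : ℕ)}) i
  · intro i j hij m hm n hn
    rw [Finset.mem_singleton] at hm hn
    subst hm hn
    exact hij

end IsSchlumprecht

end Basics

section Blocks

/-- `∑ₖ aₖ 1_{[s k, s k + l k)}`, as a linear function of the coefficients. -/
def blockSum (s l : ℕ → ℕ) : (ℕ →₀ ℝ) →ₗ[ℝ] ℕ →₀ ℝ :=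
  Finsupp.linearCombination ℝ fun k => ∑ r ∈ Finset.range (l k), Finsupp.single (s k + r) (1 : ℝ)

/-- The intervals `[s k, s k + l k)` are successive. -/
def Separated (s l : ℕ → ℕ) : Prop := ∀ ⦃k k' : ℕ⦄, k < k' → s k + l k ≤ s k'

variable {s l s' l' : ℕ → ℕ}

lemma Separated.comp (h : Separated s l) {g : ℕ → ℕ} (hg : StrictMono g) :
    Separated (s ∘ g) (l ∘ g) := fun _ _ hk => h (hg hk)

lemma Separated.eq_of_add_eq (h : Separated s l) {k k' r r' : ℕ} (hr : r < l k) (hr' : r' < l k')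
    (heq : s k + r = s k' + r') : k = k' ∧ r = r' := by
  rcases lt_trichotomy k k' with hk | rfl | hk
  · have := h hk; omega
  · exact ⟨rfl, by omega⟩
  · have := h hk; omega

lemma blockSum_single (k : ℕ) (c : ℝ) :
    blockSum s l (Finsupp.single k c) =
      c • ∑ r ∈ Finset.range (l k), Finsupp.single (s k + r) (1 : ℝ) := by
  simp [blockSum, Finsupp.linearCombination_single]

lemma blockSum_mapDomain (g : ℕ → ℕ) (a : ℕ →₀ ℝ) :
    blockSum s l (a.mapDomain g) = blockSum (s ∘ g) (l ∘ g) a :=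
  Finsupp.linearCombination_mapDomain _ _ _

lemma blockSum_apply (a : ℕ →₀ ℝ) (i : ℕ) :
    blockSum s l a i = ∑ k ∈ a.support, if s k ≤ i ∧ i < s k + l k then a k else 0 := by
  rw [blockSum, Finsupp.linearCombination_apply, Finsupp.sum, Finsupp.finsetSum_apply]
  refine Finset.sum_congr rfl fun k _ => ?_
  rw [Finsupp.smul_apply, Finsupp.finsetSum_apply]
  split_ifs with h
  · rw [Finset.sum_eq_single (i - s k)]
    · rw [Nat.add_sub_cancel' h.1]; simp
    · intro r _ hr
      exact Finsupp.single_eq_of_ne (by omega)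
    · intro hr
      exact absurd (Finset.mem_range.2 (by omega)) hr
  · rw [Finset.sum_eq_zero, smul_zero]
    intro r hr
    rw [Finset.mem_range] at hr
    exact Finsupp.single_eq_of_ne (by omega)

lemma blockSum_apply_add (h : Separated s l) (a : ℕ →₀ ℝ) {k r : ℕ} (hr : r < l k) :
    blockSum s l a (s k + r) = a k := by
  rw [blockSum_apply, Finset.sum_eq_single k]
  · rw [if_pos (by omega)]
  · intro k' _ hk'
    rw [if_neg]
    rintro ⟨h1, h2⟩
    have := h.eq_of_add_eq (k' := k') (r' := s k + r - s k') hr (by omega) (by omega)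
    exact hk' this.1.symm
  · intro hk
    rw [Finsupp.notMem_support_iff.1 hk, ite_self]

lemma exists_of_mem_support_blockSum {a : ℕ →₀ ℝ} {i : ℕ} (hi : i ∈ (blockSum s l a).support) :
    ∃ k r, k ∈ a.support ∧ r < l k ∧ i = s k + r := by
  rw [Finsupp.mem_support_iff, blockSum_apply] at hi
  obtain ⟨k, hk, hki⟩ := Finset.exists_ne_zero_of_sum_ne_zero hi
  have h : s k ≤ i ∧ i < s k + l k := by
    by_contra hc
    exact hki (if_neg hc)
  exact ⟨k, i - s k, hk, by omega, by omega⟩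

lemma blockSum_add_lengths (s l m : ℕ → ℕ) (a : ℕ →₀ ℝ) :
    blockSum s (fun k => l k + m k) a = blockSum s l a + blockSum (fun k => s k + l k) m a := by
  rw [blockSum, blockSum, blockSum, ← LinearMap.add_apply]
  congr 1
  ext k : 1
  ext
  simp [Finset.sum_range_add, add_assoc]

lemma blockSum_id_one (a : ℕ →₀ ℝ) : blockSum id (fun _ => 1) a = a := by
  have h : Separated id fun _ => 1 := fun k k' hk => hk
  ext i
  simpa using blockSum_apply_add h a (k := i) (r := 0) one_pos

/-- The left endpoint of the `k`-th interval in the partition of `ℕ` into consecutive intervals of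
lengths `l 0, l 1, …`. -/
def start (l : ℕ → ℕ) (k : ℕ) : ℕ := ∑ i ∈ Finset.range k, l i

lemma start_succ (l : ℕ → ℕ) (k : ℕ) : start l (k + 1) = start l k + l k :=
  Finset.sum_range_succ _ _

lemma start_mono (l : ℕ → ℕ) : Monotone (start l) :=
  monotone_nat_of_le_succ fun k => by rw [start_succ]; omega

lemma separated_start (l : ℕ → ℕ) : Separated (start l) l := fun k k' hk => by
  rw [← start_succ]
  exact start_mono l hk

lemma le_start {l : ℕ → ℕ} (hl : ∀ k, 0 < l k) (k : ℕ) : k ≤ start l k := by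
  induction k with
  | zero => exact Nat.zero_le _
  | succ k ih => rw [start_succ]; have := hl k; omega

lemma exists_eq_start_add {l : ℕ → ℕ} (hl : ∀ k, 0 < l k) (i : ℕ) :
    ∃ k r, r < l k ∧ i = start l k + r := by
  have hex : ∃ k, i < start l (k + 1) := ⟨i, lt_of_lt_of_le i.lt_succ_self (le_start hl _)⟩
  have h1 := Nat.find_spec hex
  have h2 : start l (Nat.find hex) ≤ i := by
    rcases Nat.eq_zero_or_pos (Nat.find hex) with h | h
    · rw [h]; exact Nat.zero_le _
    · have := Nat.find_min hex (m := Nat.find hex - 1) (by omega)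
      rwa [Nat.sub_add_cancel (Nat.succ_le_of_lt h), not_lt] at this
  rw [start_succ] at h1
  exact ⟨Nat.find hex, i - start l (Nat.find hex), by omega, by omega⟩

variable {S : Type*} [NormedAddCommGroup S] [NormedSpace ℝ S] {e : ℕ → S}

/-- Block vectors grow in norm when blocks are lengthened, coefficients are enlarged and further
blocks are inserted. -/
theorem IsSchlumprecht.norm_blockSum_le (hS : IsSchlumprecht S e) (h : Separated s l)
    (h' : Separated s' l') {g : ℕ → ℕ} (hg : StrictMono g) {a a' : ℕ →₀ ℝ}
    (hl : ∀ k, l k ≤ l' (g k)) (ha : ∀ k, |a k| ≤ |a' (g k)|) :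
    ‖embed e (blockSum s l a)‖ ≤ ‖embed e (blockSum s' l' a')‖ := by
  have hex : ∀ i, ∃ j, i ∈ (blockSum s l a).support → ∃ k r, r < l k ∧ i = s k + r ∧
      j = s' (g k) + r := by
    intro i
    by_cases hi : i ∈ (blockSum s l a).support
    · obtain ⟨k, r, -, hr, rfl⟩ := exists_of_mem_support_blockSum hi
      exact ⟨s' (g k) + r, fun _ => ⟨k, r, hr, rfl, rfl⟩⟩
    · exact ⟨0, fun h => absurd h hi⟩
  choose φ hφ using hex
  refine hS.norm_le_of_strictMonoOn (φ := φ) ?_ ?_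
  · intro i hi j hj hij
    obtain ⟨k, r, hr, rfl, hi'⟩ := hφ i hi
    obtain ⟨k', r', hr', rfl, hj'⟩ := hφ j hj
    rw [hi', hj']
    rcases lt_trichotomy k k' with hk | rfl | hk
    · have h1 := h' (hg hk)
      have h2 := hl k
      omega
    · omega
    · have := h hk
      omega
  · intro i hi
    obtain ⟨k, r, hr, rfl, hi'⟩ := hφ i hi
    rw [hi', blockSum_apply_add h _ hr, blockSum_apply_add h' _ (hr.trans_le (hl k))]
    exact ha k

theorem IsSchlumprecht.norm_blockSum_le_two_mul (hS : IsSchlumprecht S e) (h : Separated s l)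
    (h' : Separated s' l') (hl : ∀ k, l k ≤ 2 * l' k) (a : ℕ →₀ ℝ) :
    ‖embed e (blockSum s l a)‖ ≤ 2 * ‖embed e (blockSum s' l' a)‖ := by
  have hsplit : l = fun k => min (l k) (l' k) + (l k - l' k) := by
    ext k; omega
  have h1 : Separated s fun k => min (l k) (l' k) := fun k k' hk => by
    have := h hk; dsimp only; omega
  have h2 : Separated (fun k => s k + min (l k) (l' k)) fun k => l k - l' k := fun k k' hk => by
    have := h hk; dsimp only; omega
  rw [hsplit, blockSum_add_lengths, embed_add, two_mul]
  refine (norm_add_le _ _).trans (add_le_add ?_ ?_)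
  · exact hS.norm_blockSum_le h1 h' strictMono_id (fun k => min_le_right _ _) fun _ => le_rfl
  · exact hS.norm_blockSum_le h2 h' strictMono_id
      (fun k => by have := hl k; dsimp only [id]; omega) fun _ => le_rfl

end Blocks

section Averaging

/-- The index of the interval of the partition with lengths `l 0, l 1, …` containing `i`. -/
def blockIndex (l : ℕ → ℕ) (i : ℕ) : ℕ := sInf {k | i < start l (k + 1)}

/-- The averages of a finitely supported sequence over the intervals of lengths `l 0, l 1, …`. -/
def blockAverage (l : ℕ → ℕ) : (ℕ →₀ ℝ) →ₗ[ℝ] ℕ →₀ ℝ :=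
  Finsupp.linearCombination ℝ fun i => Finsupp.single (blockIndex l i) (l (blockIndex l i) : ℝ)⁻¹

/-- The rotation by `t` of each of the intervals of lengths `l 0, l 1, …`. -/
def blockRotate (l : ℕ → ℕ) (t i : ℕ) : ℕ :=
  start l (blockIndex l i) + (i - start l (blockIndex l i) + t) % l (blockIndex l i)

variable {l : ℕ → ℕ}

lemma blockIndex_start_add {k r : ℕ} (hr : r < l k) : blockIndex l (start l k + r) = k := by
  have hk : k ∈ {j | start l k + r < start l (j + 1)} := by
    rw [Set.mem_ofPred_eq, start_succ]; omega
  refine le_antisymm (Nat.sInf_le hk) ?_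
  have h := Nat.sInf_mem ⟨k, hk⟩
  rw [Set.mem_ofPred_eq] at h
  by_contra hc
  have := start_mono l (Nat.succ_le_of_lt (not_le.1 hc))
  simp only [blockIndex, Nat.succ_eq_add_one] at this
  omega

lemma blockRotate_start_add {k r : ℕ} (hr : r < l k) (t : ℕ) :
    blockRotate l t (start l k + r) = start l k + (r + t) % l k := by
  rw [blockRotate, blockIndex_start_add hr, Nat.add_sub_cancel_left]

lemma blockAverage_single {k r : ℕ} (hr : r < l k) (c : ℝ) :
    blockAverage l (Finsupp.single (start l k + r) c) = Finsupp.single k (c / l k) := by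
  rw [blockAverage, Finsupp.linearCombination_single, blockIndex_start_add hr, Finsupp.smul_single,
    smul_eq_mul, div_eq_mul_inv]

lemma blockAverage_apply (hl : ∀ k, 0 < l k) (a : ℕ →₀ ℝ) (k : ℕ) :
    blockAverage l a k = (∑ r ∈ Finset.range (l k), a (start l k + r)) / l k := by
  induction a using Finsupp.induction_linear with
  | zero => simp
  | add a b ha hb => simp [ha, hb, Finset.sum_add_distrib, add_div]
  | single i c =>
    obtain ⟨k', r', hr', rfl⟩ := exists_eq_start_add hl i
    rw [blockAverage_single hr']
    by_cases hk : k = k'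
    · subst hk
      rw [Finsupp.single_eq_same, Finset.sum_eq_single r']
      · rw [Finsupp.single_eq_same]
      · intro r _ hr
        exact Finsupp.single_eq_of_ne (by omega)
      · intro h
        exact absurd (Finset.mem_range.2 hr') h
    · rw [Finsupp.single_eq_of_ne hk, Finset.sum_eq_zero, zero_div]
      intro r hr
      refine Finsupp.single_eq_of_ne fun h => hk ?_
      exact ((separated_start l).eq_of_add_eq (Finset.mem_range.1 hr) hr' h).1

lemma blockAverage_blockSum (hl : ∀ k, 0 < l k) (a : ℕ →₀ ℝ) :
    blockAverage l (blockSum (start l) l a) = a := by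
  ext k
  have hk : (l k : ℝ) ≠ 0 := by exact_mod_cast (hl k).ne'
  rw [blockAverage_apply hl, Finset.sum_congr rfl fun r hr =>
    blockSum_apply_add (separated_start l) a (Finset.mem_range.1 hr)]
  rw [Finset.sum_const, Finset.card_range, nsmul_eq_mul, mul_div_cancel_left₀ _ hk]

lemma sum_range_add_of_periodic {G : ℕ → ℝ} {d : ℕ} (hG : ∀ n, G (n + d) = G n) (r : ℕ) :
    ∑ t ∈ Finset.range d, G (r + t) = ∑ t ∈ Finset.range d, G t := by
  induction r with
  | zero => simp
  | succ r ih =>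
    have h := Finset.sum_range_succ' (fun t => G (r + t)) d
    rw [Finset.sum_range_succ, hG r] at h
    simp only [add_zero, add_left_inj] at h
    rw [← ih, h]
    exact Finset.sum_congr rfl fun t _ => by rw [add_right_comm, add_assoc]

lemma sum_range_mul_add_mod (g : ℕ → ℝ) (d q r : ℕ) :
    ∑ t ∈ Finset.range (d * q), g ((r + t) % d) = q * ∑ t ∈ Finset.range d, g t := by
  have hG : ∀ n, g ((n + d) % d) = g (n % d) := fun n => by rw [Nat.add_mod_right]
  induction q with
  | zero => simp
  | succ q ih =>
    rw [Nat.mul_succ, Finset.sum_range_add, ih]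
    simp_rw [← add_assoc]
    rw [sum_range_add_of_periodic (G := fun n => g (n % d)) hG]
    rw [Finset.sum_congr rfl fun t ht => congrArg g (Nat.mod_eq_of_lt (Finset.mem_range.1 ht))]
    push_cast
    ring

variable {S : Type*} [NormedAddCommGroup S] [NormedSpace ℝ S] {e : ℕ → S}

lemma IsSchlumprecht.norm_le_two_mul_of_blockRotate (hS : IsSchlumprecht S e)
    (hl : ∀ k, 0 < l k) (t : ℕ) {a b : ℕ →₀ ℝ} (hb : ∀ i ∈ b.support, b i = a (blockRotate l t i)) :
    ‖embed e b‖ ≤ 2 * ‖embed e a‖ := by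
  let P : ℕ → Prop := fun i =>
    l (blockIndex l i) ≤ i - start l (blockIndex l i) + t % l (blockIndex l i)
  have hP : ∀ {k r}, r < l k → (P (start l k + r) ↔ l k ≤ r + t % l k) := fun {k r} hr => by
    simp only [P, blockIndex_start_add hr, Nat.add_sub_cancel_left]
  have hrot : ∀ {k r}, r < l k → blockRotate l t (start l k + r) =
      start l k + if l k ≤ r + t % l k then r + t % l k - l k else r + t % l k := fun {k r} hr => by
    rw [blockRotate_start_add hr, Nat.add_mod_eq_ite, Nat.mod_eq_of_lt hr]
  have key : ∀ Q : ℕ → Prop, ∀ [DecidablePred Q], (∀ i j, Q i → Q j → (P i ↔ P j)) →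
      ‖embed e (b.filter Q)‖ ≤ ‖embed e a‖ := by
    intro Q _ hQ
    refine hS.norm_le_of_strictMonoOn (φ := blockRotate l t) ?_ ?_
    · intro i hi j hj hij
      have hi := (Finset.mem_filter.1 hi).2
      have hj := (Finset.mem_filter.1 hj).2
      have hPij := hQ i j hi hj
      obtain ⟨k, r, hr, rfl⟩ := exists_eq_start_add hl i
      obtain ⟨k', r', hr', rfl⟩ := exists_eq_start_add hl j
      rw [hP hr, hP hr'] at hPij
      rcases lt_trichotomy k k' with hk | rfl | hk
      · rw [blockRotate_start_add hr, blockRotate_start_add hr']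
        have h1 := separated_start l hk
        have h2 := Nat.mod_lt (r + t) (hl k)
        omega
      · rw [hrot hr, hrot hr']
        split_ifs <;> omega
      · have h1 := separated_start l hk
        omega
    · intro i hi
      rw [Finsupp.filter_apply_pos _ _ (Finset.mem_filter.1 hi).2, hb i (Finset.mem_filter.1 hi).1]
  rw [← Finsupp.filter_add_filter_not b P, embed_add, two_mul]
  exact (norm_add_le _ _).trans
    (add_le_add (key _ fun i j hi hj => by tauto) (key _ fun i j hi hj => by tauto))

/-- Averaging over consecutive intervals has norm at most two. -/
theorem IsSchlumprecht.norm_blockSum_blockAverage_le (hS : IsSchlumprecht S e)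
    (hl : ∀ k, 0 < l k) (a : ℕ →₀ ℝ) :
    ‖embed e (blockSum (start l) l (blockAverage l a))‖ ≤ 2 * ‖embed e a‖ := by
  obtain ⟨K, hK⟩ : ∃ K, ∀ i, start l K ≤ i → a i = 0 := by
    refine ⟨a.support.sup id + 1, fun i hi => ?_⟩
    by_contra hc
    have h1 := Finset.le_sup (f := id) (Finsupp.mem_support_iff.2 hc)
    have h2 := le_start hl (a.support.sup id + 1)
    simp only [id] at h1 h2 hi
    omega
  set M := ∏ k ∈ Finset.range K, l k with hM
  have hM0 : (0 : ℝ) < M := by exact_mod_cast Finset.prod_pos fun k _ => hl k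
  let y : ℕ → ℕ →₀ ℝ := fun t => Finsupp.onFinset (Finset.range (start l K))
    (fun i => if i < start l K then a (blockRotate l t i) else 0) fun i hi => by
      by_contra hc
      exact hi (if_neg (by simpa using hc))
  have hy : ∀ t, ‖embed e (y t)‖ ≤ 2 * ‖embed e a‖ := fun t =>
    hS.norm_le_two_mul_of_blockRotate hl t fun i hi => by
      rw [Finsupp.onFinset_apply, if_pos]
      by_contra hc
      exact Finsupp.mem_support_iff.1 hi (if_neg hc)
  have hsum : ∑ t ∈ Finset.range M, y t = (M : ℝ) • blockSum (start l) l (blockAverage l a) := by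
    ext i
    obtain ⟨k, r, hr, rfl⟩ := exists_eq_start_add hl i
    rw [Finsupp.finsetSum_apply, Finsupp.smul_apply, blockSum_apply_add (separated_start l) _ hr,
      blockAverage_apply hl]
    simp only [y, Finsupp.onFinset_apply]
    by_cases hk : k < K
    · have hlt : start l k + r < start l K := by
        have := separated_start l hk
        omega
      have hlk : (l k : ℝ) ≠ 0 := by exact_mod_cast (hl k).ne'
      obtain ⟨q, hq⟩ : l k ∣ M := Finset.dvd_prod_of_mem l (Finset.mem_range.2 hk)
      simp_rw [if_pos hlt, blockRotate_start_add hr]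
      rw [hq, sum_range_mul_add_mod (fun r => a (start l k + r)), smul_eq_mul]
      push_cast
      field_simp
    · have hge : start l K ≤ start l k := start_mono l (not_lt.1 hk)
      rw [Finset.sum_eq_zero fun t _ => if_neg (by omega), Finset.sum_eq_zero, zero_div, smul_zero]
      exact fun r _ => hK _ (by omega)
  have hnorm : M * ‖embed e (blockSum (start l) l (blockAverage l a))‖ ≤ M * (2 * ‖embed e a‖) := by
    calc _ = ‖embed e (∑ t ∈ Finset.range M, y t)‖ := by
          rw [hsum, embed_smul, norm_smul, Real.norm_of_nonneg hM0.le]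
      _ = ‖∑ t ∈ Finset.range M, embed e (y t)‖ := by
          simp only [embed_eq_linearCombination, map_sum]
      _ ≤ ∑ t ∈ Finset.range M, ‖embed e (y t)‖ := norm_sum_le _ _
      _ ≤ ∑ t ∈ Finset.range M, 2 * ‖embed e a‖ := Finset.sum_le_sum fun t _ => hy t
      _ = _ := by simp
  exact le_of_mul_le_mul_left hnorm hM0

end Averaging

section FundamentalFunction

/-- `1 + (log₂ t) / 2`, a submultiplicative minorant of `schF` on `[1, ∞)`. -/
def growth (t : ℝ) : ℝ := 1 + (2 * Real.log 2)⁻¹ * Real.log t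

lemma two_mul_log_two_inv_pos : 0 < (2 * Real.log 2)⁻¹ := by
  have := Real.log_pos one_lt_two
  positivity

lemma two_mul_log_two_inv_le_one : (2 * Real.log 2)⁻¹ ≤ 1 :=
  inv_le_one_of_one_le₀ (by linarith [Real.log_two_gt_d9])

lemma one_le_growth {t : ℝ} (ht : 1 ≤ t) : 1 ≤ growth t :=
  le_add_of_nonneg_right (mul_nonneg two_mul_log_two_inv_pos.le (Real.log_nonneg ht))

lemma growth_mono {s t : ℝ} (hs : 0 < s) (h : s ≤ t) : growth s ≤ growth t := by
  have := two_mul_log_two_inv_pos.le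
  have := Real.log_le_log hs h
  unfold growth
  gcongr

lemma growth_two_pow (m : ℕ) : growth (2 ^ m) = 1 + m / 2 := by
  have := Real.log_pos one_lt_two
  rw [growth, Real.log_pow]
  field_simp

lemma growth_le_schF {t : ℝ} (ht : 0 < t) : growth t ≤ schF t := by
  have h2 := Real.log_pos one_lt_two
  have h1 : Real.log (4 * t) ≤ Real.log ((t + 1) ^ 2) :=
    Real.log_le_log (by positivity) (by nlinarith [sq_nonneg (t - 1)])
  have h4 : Real.log 4 = 2 * Real.log 2 := by
    rw [show (4 : ℝ) = 2 ^ 2 by norm_num, Real.log_pow]; norm_num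
  rw [Real.log_mul (by norm_num) ht.ne', Real.log_pow, h4] at h1
  rw [growth, schF, Real.logb, le_div_iff₀ h2]
  push_cast at h1
  have : (1 + (2 * Real.log 2)⁻¹ * Real.log t) * Real.log 2 = (2 * Real.log 2 + Real.log t) / 2 := by
    field_simp
  linarith

lemma growth_le_self {t : ℝ} (ht : 1 ≤ t) : growth t ≤ t := by
  have h1 := Real.log_le_sub_one_of_pos (by linarith : 0 < t)
  have h2 := mul_le_mul two_mul_log_two_inv_le_one h1 (Real.log_nonneg ht) zero_le_one
  unfold growth
  linarith

lemma div_growth_le {x n r : ℝ} (hx : 1 ≤ x) (hxn : x ≤ n) (hr : 0 < r) :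
    x / growth x ≤ (x * (growth r - (2 * Real.log 2)⁻¹) + (2 * Real.log 2)⁻¹ * (n / r)) /
      growth n := by
  have hc := two_mul_log_two_inv_pos
  have hx0 : 0 < x := by linarith
  have hn0 : 0 < n := by linarith
  have hgx := one_le_growth hx
  have hgn := one_le_growth (hx.trans hxn)
  set c := (2 * Real.log 2)⁻¹ with hcdef
  have hsub : growth n ≤ growth x * growth (n / x) := by
    have h1 : growth n = growth x + c * Real.log (n / x) := by
      rw [growth, growth, ← hcdef, Real.log_div hn0.ne' hx0.ne']; ring
    have h2 : 0 ≤ c * Real.log (n / x) :=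
      mul_nonneg hc.le (Real.log_nonneg ((one_le_div hx0).2 hxn))
    have h3 : growth (n / x) = 1 + c * Real.log (n / x) := rfl
    rw [h1, h3]
    nlinarith
  have htan : x * growth (n / x) ≤ x * (growth r - c) + c * (n / r) := by
    have h1 := Real.log_le_sub_one_of_pos (by positivity : 0 < n / x / r)
    rw [Real.log_div (by positivity) hr.ne'] at h1
    have h2 : x * growth (n / x) ≤ x * (1 + c * (n / x / r - 1 + Real.log r)) := by
      have h3 : growth (n / x) = 1 + c * Real.log (n / x) := rfl
      rw [h3]
      gcongr
      linarith
    have h4 : x * (1 + c * (n / x / r - 1 + Real.log r)) =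
        x * (growth r - c) + c * (n / r) := by
      rw [growth, ← hcdef]
      field_simp
      ring
    linarith
  rw [div_le_div_iff₀ (by linarith) (by linarith)]
  calc x * growth n ≤ x * (growth x * growth (n / x)) := by gcongr
    _ = (x * growth (n / x)) * growth x := by ring
    _ ≤ _ := by gcongr

lemma Succ.sum_div_growth_le {r : ℕ} (hr : 2 ≤ r) {E : Fin r → Finset ℕ} (hE : Succ E)
    (F : Finset ℕ) :
    ∑ i, ((F.filter (· ∈ E i)).card : ℝ) / growth ((F.filter (· ∈ E i)).card) ≤
      schF r * (F.card / growth F.card) := by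
  rcases F.eq_empty_or_nonempty with rfl | hF
  · simp
  have hn : (1 : ℝ) ≤ F.card := by exact_mod_cast hF.card_pos
  have hr0 : (0 : ℝ) < r := by positivity
  have hr1 : (1 : ℝ) ≤ r := by exact_mod_cast (by omega : 1 ≤ r)
  have hc := two_mul_log_two_inv_pos
  have hgn := one_le_growth hn
  have hcr : 0 ≤ growth r - (2 * Real.log 2)⁻¹ := by
    linarith [one_le_growth hr1, two_mul_log_two_inv_le_one]
  have hterm : ∀ i, ((F.filter (· ∈ E i)).card : ℝ) / growth ((F.filter (· ∈ E i)).card) ≤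
      ((F.filter (· ∈ E i)).card * (growth r - (2 * Real.log 2)⁻¹) +
        (2 * Real.log 2)⁻¹ * (F.card / r)) / growth F.card := by
    intro i
    rcases (F.filter (· ∈ E i)).eq_empty_or_nonempty with h | h
    · rw [h, Finset.card_empty, Nat.cast_zero, zero_div, zero_mul, zero_add]
      positivity
    · exact div_growth_le (by exact_mod_cast h.card_pos)
        (by exact_mod_cast Finset.card_filter_le _ _) hr0
  have hsum : ∑ i, ((F.filter (· ∈ E i)).card : ℝ) ≤ F.card := by
    simpa using hE.sum_sum_le F (w := fun _ => 1) fun _ => zero_le_one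
  refine (Finset.sum_le_sum fun i _ => hterm i).trans ?_
  rw [← Finset.sum_div, Finset.sum_add_distrib, ← Finset.sum_mul, Finset.sum_const,
    Finset.card_univ, Fintype.card_fin, nsmul_eq_mul]
  have h1 : (r : ℝ) * ((2 * Real.log 2)⁻¹ * (F.card / r)) = F.card * (2 * Real.log 2)⁻¹ := by
    field_simp
  have h2 := mul_le_mul_of_nonneg_right hsum hcr
  have h3 := mul_le_mul_of_nonneg_right (growth_le_schF hr0) (by linarith : (0 : ℝ) ≤ F.card)
  rw [h1, ← mul_div_assoc]
  gcongr
  linarith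

variable {S : Type*} [NormedAddCommGroup S] [NormedSpace ℝ S] {e : ℕ → S}

/-- Upper estimate for the fundamental function of the Schlumprecht space. -/
theorem IsSchlumprecht.norm_le_card_div_growth (hS : IsSchlumprecht S e) {a : ℕ →₀ ℝ}
    {F : Finset ℕ} (ha : ∀ i, |a i| ≤ if i ∈ F then 1 else 0) :
    ‖embed e a‖ ≤ F.card / growth F.card := by
  refine hS.norm_le_of_supersolution
    (R := fun a m => ∃ F : Finset ℕ, (∀ i, |a i| ≤ if i ∈ F then 1 else 0) ∧
      m = F.card / growth F.card) ?_ ?_ a _ ⟨F, ha, rfl⟩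
  · rintro a _ ⟨F, ha, rfl⟩ i
    rcases F.eq_empty_or_nonempty with rfl | hF
    · simpa using ha i
    · have hn : (1 : ℝ) ≤ F.card := by exact_mod_cast hF.card_pos
      have h1 : (1 : ℝ) ≤ F.card / growth F.card := by
        rw [one_le_div (by linarith [one_le_growth hn])]
        exact growth_le_self hn
      refine (ha i).trans (le_trans ?_ h1)
      split_ifs <;> norm_num
  · rintro a _ ⟨F, ha, rfl⟩ r hr E hE
    refine ⟨_, fun i => ⟨F.filter (· ∈ E i), fun k => ?_, rfl⟩, hE.sum_div_growth_le hr F⟩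
    rw [restr_apply]
    have := ha k
    by_cases hk : k ∈ E i <;> simp_all

end FundamentalFunction

section Isomorphism

/-- The interval lengths `1, 1, 1, 2, 1, 3, 1, 4, …`: singletons alternate with intervals of
increasing length. -/
def mixedLength (j : ℕ) : ℕ := if j % 2 = 0 then 1 else j / 2 + 1

lemma mixedLength_even (k : ℕ) : mixedLength (2 * k) = 1 := by
  simp [mixedLength]

lemma mixedLength_odd (k : ℕ) : mixedLength (2 * k + 1) = k + 1 := by
  rw [mixedLength, if_neg (by omega)]
  omega

lemma mixedLength_pos (j : ℕ) : 0 < mixedLength j := by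
  unfold mixedLength
  split_ifs <;> omega

lemma mixedLength_le (j : ℕ) : mixedLength j ≤ j + 1 := by
  unfold mixedLength
  split_ifs <;> omega

lemma start_mixedLength_le (j : ℕ) : start mixedLength j ≤ j * j := by
  refine (Finset.sum_le_card_nsmul _ _ j fun i hi => ?_).trans (by simp)
  exact (mixedLength_le i).trans (Finset.mem_range.1 hi)

lemma strictMono_two_mul : StrictMono fun k : ℕ => 2 * k := fun _ _ h => by dsimp only; omega

lemma strictMono_two_mul_add_one : StrictMono fun k : ℕ => 2 * k + 1 :=
  fun _ _ h => by dsimp only; omega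

/-- Interleaving of two sequences. -/
def interleave : (ℕ →₀ ℝ) × (ℕ →₀ ℝ) →ₗ[ℝ] ℕ →₀ ℝ :=
  (Finsupp.lmapDomain ℝ ℝ fun k => 2 * k).coprod (Finsupp.lmapDomain ℝ ℝ fun k => 2 * k + 1)

lemma interleave_apply (y z : ℕ →₀ ℝ) : interleave (y, z) =
    y.mapDomain (fun k => 2 * k) + z.mapDomain fun k => 2 * k + 1 := rfl

lemma interleave_even (y z : ℕ →₀ ℝ) (k : ℕ) : interleave (y, z) (2 * k) = y k := by
  rw [interleave_apply, Finsupp.add_apply,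
    Finsupp.mapDomain_apply strictMono_two_mul.injective (x := y) k,
    Finsupp.mapDomain_of_notMem_range, add_zero]
  rintro ⟨j, hj⟩
  dsimp only at hj
  omega

lemma interleave_odd (y z : ℕ →₀ ℝ) (k : ℕ) : interleave (y, z) (2 * k + 1) = z k := by
  rw [interleave_apply, Finsupp.add_apply,
    Finsupp.mapDomain_apply strictMono_two_mul_add_one.injective (x := z) k,
    Finsupp.mapDomain_of_notMem_range, zero_add]
  rintro ⟨j, hj⟩
  dsimp only at hj
  omega

lemma interleave_surjective : Function.Surjective interleave := by
  intro w
  refine ⟨(w.comapDomain (fun k => 2 * k) strictMono_two_mul.injective.injOn,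
    w.comapDomain (fun k => 2 * k + 1) strictMono_two_mul_add_one.injective.injOn), ?_⟩
  ext i
  obtain ⟨k, rfl | rfl⟩ := i.even_or_odd'
  · rw [interleave_even]; rfl
  · rw [interleave_odd]; rfl

lemma blockSum_interleave (s l : ℕ → ℕ) (y z : ℕ →₀ ℝ) : blockSum s l (interleave (y, z)) =
    blockSum (s ∘ fun k => 2 * k) (l ∘ fun k => 2 * k) y +
      blockSum (s ∘ fun k => 2 * k + 1) (l ∘ fun k => 2 * k + 1) z := by
  rw [interleave_apply, map_add, blockSum_mapDomain, blockSum_mapDomain]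

/-- Replaces the averages of the first sequence over the intervals of lengths `1, 2, 3, …` by their
interleaving with the second sequence. -/
def absorb : (ℕ →₀ ℝ) × (ℕ →₀ ℝ) →ₗ[ℝ] ℕ →₀ ℝ :=
  (LinearMap.id - blockSum (start Nat.succ) Nat.succ ∘ₗ blockAverage Nat.succ) ∘ₗ
      LinearMap.fst ℝ _ _ +
    blockSum (start Nat.succ) Nat.succ ∘ₗ interleave ∘ₗ
      (blockAverage Nat.succ).prodMap LinearMap.id

lemma absorb_apply (a y : ℕ →₀ ℝ) : absorb (a, y) =
    a - blockSum (start Nat.succ) Nat.succ (blockAverage Nat.succ a) +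
      blockSum (start Nat.succ) Nat.succ (interleave (blockAverage Nat.succ a, y)) := rfl

lemma blockAverage_absorb (a y : ℕ →₀ ℝ) :
    blockAverage Nat.succ (absorb (a, y)) = interleave (blockAverage Nat.succ a, y) := by
  simp [absorb_apply, blockAverage_blockSum Nat.succ_pos]

lemma absorb_surjective : Function.Surjective absorb := by
  intro x
  obtain ⟨⟨y, z⟩, hyz⟩ := interleave_surjective (blockAverage Nat.succ x)
  refine ⟨(x - blockSum (start Nat.succ) Nat.succ (blockAverage Nat.succ x) +
    blockSum (start Nat.succ) Nat.succ y, z), ?_⟩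
  simp [absorb_apply, blockAverage_blockSum Nat.succ_pos, hyz]

variable {S : Type*} [NormedAddCommGroup S] [NormedSpace ℝ S] {e : ℕ → S}

namespace IsSchlumprecht

variable (hS : IsSchlumprecht S e)
include hS

lemma norm_absorb_le (a y : ℕ →₀ ℝ) : ‖embed e (absorb (a, y))‖ ≤
    9 * ‖embed e (blockSum (start mixedLength) mixedLength (interleave (a, y)))‖ := by
  have hX := separated_start mixedLength
  have hI := separated_start Nat.succ
  have h1 : ‖embed e a‖ ≤
      ‖embed e (blockSum (start mixedLength) mixedLength (interleave (a, y)))‖ := by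
    conv_lhs => rw [← blockSum_id_one a]
    exact hS.norm_blockSum_le (fun k k' hk => hk) hX strictMono_two_mul
      (fun k => mixedLength_pos _) fun k => by rw [interleave_even]
  have h2 : ‖embed e (blockSum (start Nat.succ) Nat.succ y)‖ ≤
      ‖embed e (blockSum (start mixedLength) mixedLength (interleave (a, y)))‖ :=
    hS.norm_blockSum_le hI hX strictMono_two_mul_add_one
      (fun k => (mixedLength_odd k).ge) fun k => by rw [interleave_odd]
  have h3 := hS.norm_blockSum_blockAverage_le Nat.succ_pos a
  have h4 : ∀ y, ‖embed e (blockSum (start Nat.succ ∘ fun k => 2 * k)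
      (Nat.succ ∘ fun k => 2 * k) y)‖ ≤ 2 * ‖embed e (blockSum (start Nat.succ) Nat.succ y)‖ :=
    hS.norm_blockSum_le_two_mul (hI.comp strictMono_two_mul) hI fun k => by
      simp only [Function.comp]; omega
  have h5 : ∀ y, ‖embed e (blockSum (start Nat.succ ∘ fun k => 2 * k + 1)
      (Nat.succ ∘ fun k => 2 * k + 1) y)‖ ≤
      2 * ‖embed e (blockSum (start Nat.succ) Nat.succ y)‖ :=
    hS.norm_blockSum_le_two_mul (hI.comp strictMono_two_mul_add_one) hI fun k => by
      simp only [Function.comp]; omega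
  have h4 := h4 (blockAverage Nat.succ a)
  have h5 := h5 y
  rw [absorb_apply, blockSum_interleave (start Nat.succ), embed_add, embed_sub, embed_add]
  refine (norm_add_le _ _).trans ?_
  have h6 := norm_sub_le (embed e a)
    (embed e (blockSum (start Nat.succ) Nat.succ (blockAverage Nat.succ a)))
  refine (add_le_add h6 (norm_add_le _ _)).trans ?_
  linarith

lemma norm_le_norm_absorb (a y : ℕ →₀ ℝ) :
    ‖embed e (blockSum (start mixedLength) mixedLength (interleave (a, y)))‖ ≤
      7 * ‖embed e (absorb (a, y))‖ := by
  have hX := separated_start mixedLength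
  have hI := separated_start Nat.succ
  have h0 := hS.norm_blockSum_blockAverage_le Nat.succ_pos (absorb (a, y))
  rw [blockAverage_absorb] at h0
  have h1 : ‖embed e (blockSum (start Nat.succ) Nat.succ (blockAverage Nat.succ a))‖ ≤
      ‖embed e (blockSum (start Nat.succ) Nat.succ (interleave (blockAverage Nat.succ a, y)))‖ :=
    hS.norm_blockSum_le hI hI strictMono_two_mul (fun k => by omega)
      fun k => by rw [interleave_even]
  have h2 : ‖embed e (blockSum (start Nat.succ) Nat.succ y)‖ ≤
      ‖embed e (blockSum (start Nat.succ) Nat.succ (interleave (blockAverage Nat.succ a, y)))‖ :=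
    hS.norm_blockSum_le hI hI strictMono_two_mul_add_one (fun k => by omega)
      fun k => by rw [interleave_odd]
  have h3 : ‖embed e a‖ ≤ ‖embed e (absorb (a, y))‖ +
      ‖embed e (blockSum (start Nat.succ) Nat.succ (interleave (blockAverage Nat.succ a, y)))‖ +
      ‖embed e (blockSum (start Nat.succ) Nat.succ (blockAverage Nat.succ a))‖ := by
    have : a = absorb (a, y) -
        blockSum (start Nat.succ) Nat.succ (interleave (blockAverage Nat.succ a, y)) +
        blockSum (start Nat.succ) Nat.succ (blockAverage Nat.succ a) := by
      rw [absorb_apply]; abel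
    conv_lhs => rw [this, embed_add, embed_sub]
    exact (norm_add_le _ _).trans (add_le_add_left (norm_sub_le _ _) _)
  have h4 : ‖embed e (blockSum (start mixedLength ∘ fun k => 2 * k)
      (mixedLength ∘ fun k => 2 * k) a)‖ ≤ ‖embed e a‖ := by
    conv_rhs => rw [← blockSum_id_one a]
    exact hS.norm_blockSum_le (hX.comp strictMono_two_mul) (fun k k' hk => hk) strictMono_id
      (fun k => (mixedLength_even k).le) fun k => le_rfl
  have h5 : ‖embed e (blockSum (start mixedLength ∘ fun k => 2 * k + 1)
      (mixedLength ∘ fun k => 2 * k + 1) y)‖ ≤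
      ‖embed e (blockSum (start Nat.succ) Nat.succ y)‖ :=
    hS.norm_blockSum_le (hX.comp strictMono_two_mul_add_one) hI strictMono_id
      (fun k => (mixedLength_odd k).le) fun k => le_rfl
  rw [blockSum_interleave (start mixedLength), embed_add]
  refine (norm_add_le _ _).trans ?_
  linarith

/-- The blocks of lengths `1, 1, 1, 2, 1, 3, …` span a space isomorphic to the Schlumprecht space. -/
theorem nonempty_closure_blockSum_equiv [CompleteSpace S] :
    Nonempty ((LinearMap.range (Finsupp.linearCombination ℝ e ∘ₗ
      blockSum (start mixedLength) mixedLength)).topologicalClosure ≃L[ℝ] S) := by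
  set W := LinearMap.range (Finsupp.linearCombination ℝ e ∘ₗ
    blockSum (start mixedLength) mixedLength) with hW
  have : CompleteSpace W.topologicalClosure :=
    W.isClosed_topologicalClosure.completeSpace_coe
  let f : (ℕ →₀ ℝ) × (ℕ →₀ ℝ) →ₗ[ℝ] W.topologicalClosure :=
    (Finsupp.linearCombination ℝ e ∘ₗ blockSum (start mixedLength) mixedLength ∘ₗ
      interleave).codRestrict _ fun v => W.le_topologicalClosure ⟨interleave v, rfl⟩
  let g : (ℕ →₀ ℝ) × (ℕ →₀ ℝ) →ₗ[ℝ] S := Finsupp.linearCombination ℝ e ∘ₗ absorb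
  have hf : DenseRange f := by
    intro x
    rw [closure_subtype]
    refine closure_mono ?_ x.2
    rintro _ ⟨w, rfl⟩
    obtain ⟨v, rfl⟩ := interleave_surjective w
    exact ⟨f v, ⟨v, rfl⟩, rfl⟩
  have hg : DenseRange g := by
    refine hS.dense_span.mono ?_
    intro x hx
    rw [SetLike.mem_coe, ← Finsupp.range_linearCombination] at hx
    obtain ⟨a, rfl⟩ := hx
    obtain ⟨v, rfl⟩ := absorb_surjective a
    exact ⟨v, rfl⟩
  exact ⟨(LinearEquiv.refl ℝ ((ℕ →₀ ℝ) × (ℕ →₀ ℝ))).extend f g hf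
    ⟨9, fun v => hS.norm_absorb_le v.1 v.2⟩ hg ⟨7, fun v => hS.norm_le_norm_absorb v.1 v.2⟩⟩

end IsSchlumprecht

end Isomorphism

section NormalizedBlocks

variable {S : Type*} [NormedAddCommGroup S] [NormedSpace ℝ S] {e : ℕ → S} {l : ℕ → ℕ}

/-- The normalized indicator of the `k`-th interval of the partition with lengths
`l 0, l 1, …`. -/
def unitBlock (e : ℕ → S) (l : ℕ → ℕ) (k : ℕ) : ℕ →₀ ℝ :=
  ‖embed e (blockSum (start l) l (Finsupp.single k 1))‖⁻¹ •
    blockSum (start l) l (Finsupp.single k 1)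

lemma unitBlock_eq (e : ℕ → S) (l : ℕ → ℕ) (k : ℕ) : unitBlock e l k =
    blockSum (start l) l
      (Finsupp.single k ‖embed e (blockSum (start l) l (Finsupp.single k 1))‖⁻¹) := by
  rw [unitBlock, ← map_smul, Finsupp.smul_single, smul_eq_mul, mul_one]

namespace IsSchlumprecht

variable (hS : IsSchlumprecht S e)
include hS

lemma one_le_norm_blockSum_single (hl : ∀ k, 0 < l k) (k : ℕ) :
    1 ≤ ‖embed e (blockSum (start l) l (Finsupp.single k 1))‖ := by
  have h := hS.abs_le_norm (blockSum (start l) l (Finsupp.single k 1)) (start l k + 0)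
  rwa [blockSum_apply_add (separated_start l) _ (hl k), Finsupp.single_eq_same, abs_one] at h

lemma norm_blockSum_single_le (l : ℕ → ℕ) (k : ℕ) :
    ‖embed e (blockSum (start l) l (Finsupp.single k 1))‖ ≤ l k / growth (l k) := by
  have h := hS.norm_le_card_div_growth (a := blockSum (start l) l (Finsupp.single k 1))
    (F := Finset.Ico (start l k) (start l k + l k)) fun i => ?_
  · simpa using h
  · rw [blockSum_apply, Finsupp.support_single _ one_ne_zero, Finset.sum_singleton,
      Finsupp.single_eq_same]
    simp only [Finset.mem_Ico]
    split_ifs <;> simp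

lemma norm_unitBlock (hl : ∀ k, 0 < l k) (k : ℕ) : ‖embed e (unitBlock e l k)‖ = 1 := by
  have h := hS.one_le_norm_blockSum_single hl k
  rw [unitBlock, embed_smul, norm_smul, norm_inv, norm_norm, inv_mul_cancel₀ (by linarith)]

lemma isNormalizedBlockBasis_unitBlock (hl : ∀ k, 0 < l k) :
    IsNormalizedBlockBasis e (unitBlock e l) := by
  refine ⟨fun k h0 => ?_, fun k m hm n hn => ?_, hS.norm_unitBlock hl⟩
  · have := hS.norm_unitBlock hl k
    rw [h0, embed_zero, norm_zero] at this
    exact zero_ne_one this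
  · rw [unitBlock_eq] at hm hn
    obtain ⟨j, r, hj, hr, rfl⟩ := exists_of_mem_support_blockSum hm
    obtain ⟨j', r', hj', hr', rfl⟩ := exists_of_mem_support_blockSum hn
    obtain rfl := Finset.mem_singleton.1 (Finsupp.support_single_subset hj)
    obtain rfl := Finset.mem_singleton.1 (Finsupp.support_single_subset hj')
    rw [start_succ]
    omega

lemma span_unitBlock (hl : ∀ k, 0 < l k) :
    Submodule.span ℝ (Set.range fun k => embed e (unitBlock e l k)) =
      LinearMap.range (Finsupp.linearCombination ℝ e ∘ₗ blockSum (start l) l) := by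
  apply le_antisymm
  · rw [Submodule.span_le]
    rintro _ ⟨k, rfl⟩
    exact ⟨_, congrArg (embed e) (unitBlock_eq e l k).symm⟩
  · rintro _ ⟨w, rfl⟩
    induction w using Finsupp.induction_linear with
    | zero => rw [map_zero]; exact Submodule.zero_mem _
    | add w w' hw hw' => rw [map_add]; exact Submodule.add_mem _ hw hw'
    | single k c =>
      have hk := hS.one_le_norm_blockSum_single hl k
      have : (Finsupp.linearCombination ℝ e ∘ₗ blockSum (start l) l) (Finsupp.single k c) =
          (c * ‖embed e (blockSum (start l) l (Finsupp.single k 1))‖) •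
            embed e (unitBlock e l k) := by
        rw [unitBlock, embed_smul, smul_smul, mul_assoc, mul_inv_cancel₀ (by linarith), mul_one,
          ← embed_smul, ← map_smul, Finsupp.smul_single, smul_eq_mul, mul_one]
        rfl
      rw [this]
      exact Submodule.smul_mem _ _ (Submodule.subset_span ⟨k, rfl⟩)

/-- Sums of long normalized blocks of comparable lengths are large. -/
lemma mul_growth_le_norm_sum_unitBlock {n : ℕ} (hn : 0 < n) :
    n * growth n ≤ schF ((16 * n ^ 2 : ℕ) : ℝ) *
      ‖embed e (∑ k ∈ Finset.Ico n (2 * n), unitBlock e mixedLength (2 * k + 1))‖ := by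
  have hr : 2 ≤ 16 * n ^ 2 := by nlinarith
  refine le_trans ?_ (hS.sum_le_schF_mul_norm _ hr)
  have hone : ∀ k ∈ Finset.Ico n (2 * n), growth n ≤
      ∑ i ∈ Finset.range (16 * n ^ 2), unitBlock e mixedLength (2 * k + 1) i := by
    intro k hk
    rw [Finset.mem_Ico] at hk
    have hk1 : (1 : ℝ) ≤ (k + 1 : ℕ) := by exact_mod_cast Nat.succ_pos k
    have hg := one_le_growth hk1
    have hup := hS.norm_blockSum_single_le mixedLength (2 * k + 1)
    have hlow := hS.one_le_norm_blockSum_single mixedLength_pos (2 * k + 1)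
    rw [mixedLength_odd] at hup
    have hsum : ∑ i ∈ Finset.range (16 * n ^ 2), unitBlock e mixedLength (2 * k + 1) i =
        ‖embed e (blockSum (start mixedLength) mixedLength (Finsupp.single (2 * k + 1) 1))‖⁻¹ *
          (k + 1 : ℕ) := by
      simp_rw [unitBlock, Finsupp.smul_apply, smul_eq_mul]
      rw [← Finset.mul_sum, blockSum_single, one_smul, mixedLength_odd]
      congr 1
      simp_rw [Finsupp.finsetSum_apply]
      rw [Finset.sum_comm, Finset.sum_congr rfl (g := fun _ => (1 : ℝ))]
      · simp
      · intro r hr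
        rw [Finset.mem_range] at hr
        have h1 := start_mixedLength_le (4 * n)
        have h2 := start_mono mixedLength (by omega : 2 * k + 1 + 1 ≤ 4 * n)
        rw [start_succ, mixedLength_odd] at h2
        have h3 : start mixedLength (2 * k + 1) + r < 16 * n ^ 2 := by nlinarith
        rw [Finset.sum_eq_single (start mixedLength (2 * k + 1) + r)]
        · rw [Finsupp.single_eq_same]
        · exact fun i _ hi => Finsupp.single_eq_of_ne hi
        · exact fun h => absurd (Finset.mem_range.2 h3) h
    rw [hsum, inv_mul_eq_div, le_div_iff₀ (by linarith)]
    have hgn : growth n ≤ growth (k + 1 : ℕ) :=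
      growth_mono (by exact_mod_cast hn) (by exact_mod_cast (by omega : n ≤ k + 1))
    rw [le_div_iff₀ (by linarith)] at hup
    nlinarith
  calc (n : ℝ) * growth n = ∑ k ∈ Finset.Ico n (2 * n), growth n := by
        rw [Finset.sum_const, Nat.card_Ico, nsmul_eq_mul]
        congr 2
        omega
    _ ≤ ∑ k ∈ Finset.Ico n (2 * n),
        ∑ i ∈ Finset.range (16 * n ^ 2), unitBlock e mixedLength (2 * k + 1) i :=
      Finset.sum_le_sum hone
    _ = ∑ i ∈ Finset.range (16 * n ^ 2),
        (∑ k ∈ Finset.Ico n (2 * n), unitBlock e mixedLength (2 * k + 1)) i := by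
      rw [Finset.sum_comm]
      simp_rw [Finsupp.finsetSum_apply]
    _ ≤ _ := Finset.sum_le_sum fun i _ => le_abs_self _

theorem not_seqEquivalent_unitBlock (π : Equiv.Perm ℕ) :
    ¬ SeqEquivalent (fun i => embed e (unitBlock e mixedLength (π i))) e := by
  rintro ⟨A, B, hA, -, hAB⟩
  obtain ⟨m, hm⟩ := exists_nat_gt (10 * A)
  set n := 2 ^ m with hn
  have hn0 : 0 < n := by positivity
  let σ : ℕ → ℕ := fun k => π.symm (2 * k + 1)
  have hσ : Function.Injective σ := π.symm.injective.comp strictMono_two_mul_add_one.injective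
  let a : ℕ →₀ ℝ := ∑ k ∈ Finset.Ico n (2 * n), Finsupp.single (σ k) 1
  have hup : ‖embed e a‖ ≤ n / growth n := by
    have h := hS.norm_le_card_div_growth (a := a) (F := (Finset.Ico n (2 * n)).image σ) fun i => ?_
    · rw [Finset.card_image_of_injective _ hσ, Nat.card_Ico, show 2 * n - n = n by omega] at h
      exact h
    · simp only [a, Finsupp.finsetSum_apply]
      split_ifs with hi
      · obtain ⟨k, hk, rfl⟩ := Finset.mem_image.1 hi
        rw [Finset.sum_eq_single k, Finsupp.single_eq_same, abs_one]
        · exact fun k' _ hk' => Finsupp.single_eq_of_ne fun h => hk' (hσ h).symm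
        · exact fun h => absurd hk h
      · rw [Finset.sum_eq_zero, abs_zero]
        exact fun k hk => Finsupp.single_eq_of_ne fun h =>
          hi (h ▸ Finset.mem_image_of_mem σ hk)
  have hlow := hS.mul_growth_le_norm_sum_unitBlock hn0
  have hcomp := (hAB a).1
  have hsum : (a.sum fun i c => c • embed e (unitBlock e mixedLength (π i))) =
      embed e (∑ k ∈ Finset.Ico n (2 * n), unitBlock e mixedLength (2 * k + 1)) := by
    change Finsupp.linearCombination ℝ (fun i => embed e (unitBlock e mixedLength (π i))) a = _
    simp only [a, map_sum, Finsupp.linearCombination_single, one_smul, σ, Equiv.apply_symm_apply,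
      embed_eq_linearCombination]
  rw [hsum, inv_mul_le_iff₀ hA] at hcomp
  change _ ≤ A * ‖embed e a‖ at hcomp
  have hg : growth n = 1 + m / 2 := by
    rw [hn, Nat.cast_pow, Nat.cast_ofNat, growth_two_pow]
  have hf : schF ((16 * n ^ 2 : ℕ) : ℝ) ≤ 5 * growth n := by
    have h1 : ((16 * n ^ 2 : ℕ) : ℝ) + 1 ≤ 2 ^ (2 * m + 5) := by
      have : 1 ≤ n ^ 2 := Nat.one_le_pow _ _ hn0
      have h2 : 2 ^ (2 * m + 5) = 32 * n ^ 2 := by rw [hn]; ring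
      exact_mod_cast (by omega : 16 * n ^ 2 + 1 ≤ 2 ^ (2 * m + 5))
    have h2 := Real.logb_le_logb_of_le one_lt_two (by positivity) h1
    rw [Real.logb_pow, Real.logb_self_eq_one one_lt_two] at h2
    rw [schF, hg]
    push_cast at h2 ⊢
    linarith
  have hgpos : 0 < growth n := by rw [hg]; positivity
  have hnpos : (0 : ℝ) < n := by exact_mod_cast hn0
  have hfin : n * growth n ≤ 5 * growth n * (A * (n / growth n)) := by
    refine hlow.trans ?_
    gcongr
    exact hcomp.trans (by gcongr)
  have : 5 * growth n * (A * (n / growth n)) = n * (5 * A) := by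
    field_simp
  rw [this] at hfin
  have := le_of_mul_le_mul_left hfin hnpos
  rw [hg] at this
  linarith

end IsSchlumprecht

lemma exists_unitBlock_eq_smul_sum_Icc (e : ℕ → S) (hl : ∀ k, 0 < l k) (k : ℕ) :
    ∃ (c : ℝ) (p q : ℕ), p ≤ q ∧
      unitBlock e l k = c • ∑ j ∈ Finset.Icc p q, Finsupp.single j (1 : ℝ) := by
  have := hl k
  refine ⟨‖embed e (blockSum (start l) l (Finsupp.single k 1))‖⁻¹, start l k,
    start l k + l k - 1, by omega, ?_⟩
  rw [unitBlock]
  congr 1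
  rw [blockSum_single, one_smul]
  have : Finset.Icc (start l k) (start l k + l k - 1) =
      Finset.Ico (start l k) (start l k + l k) := by
    ext i
    rw [Finset.mem_Icc, Finset.mem_Ico]
    omega
  rw [this, Finset.sum_Ico_eq_sum_range, Nat.add_sub_cancel_left]

end NormalizedBlocks

/-- There is a normalized block basis `(u i)` of `(e i)` in the Schlumprecht
space, each `u i` a normalized multiple of a sum of consecutive basis vectors, whose closed
linear span is isomorphic to `S`, and such that no permutation of `(u i)` is equivalent
to `(e i)`. -/
theorem exists_constant_coefficient_block_basis_not_equivalent {S : Type*}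
    [NormedAddCommGroup S] [NormedSpace ℝ S] [CompleteSpace S]
    (e : ℕ → S) (hS : IsSchlumprecht S e) :
    ∃ b : ℕ → (ℕ →₀ ℝ), IsNormalizedBlockBasis e b ∧
      (∀ k, ∃ (c : ℝ) (p q : ℕ), p ≤ q ∧
        b k = c • ∑ j ∈ Finset.Icc p q, Finsupp.single j (1 : ℝ)) ∧
      Nonempty
        (((Submodule.span ℝ (Set.range fun k => embed e (b k))).topologicalClosure) ≃L[ℝ] S) ∧
      ∀ π : Equiv.Perm ℕ, ¬ SeqEquivalent (fun i => embed e (b (π i))) e := by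
  refine ⟨unitBlock e mixedLength, hS.isNormalizedBlockBasis_unitBlock mixedLength_pos,
    exists_unitBlock_eq_smul_sum_Icc e mixedLength_pos, ?_, hS.not_seqEquivalent_unitBlock⟩
  rw [hS.span_unitBlock mixedLength_pos]
  exact hS.nonempty_closure_blockSum_equiv
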